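/- arXiv:1605.08165 — 4 statements merged into one kernel-verified Lean document; each statement's English description precedes it below -/
import Mathlib

section
/- Let f : ℝ^d → ℝ be convex, let δ > 0, and let k : [−1,1] → ℝ be a bounded measurable kernel. Define f̂_δ(x) = E[f(x + r δ v) r k(r)], where r is uniformly distributed on [−1,1] and v is independent of r and uniformly distributed on the closed Euclidean unit ball of ℝ^d. Then f̂_δ is differentiable on ℝ^d and, for every x ∈ ℝ^d, ∇f̂_δ(x) = (d/δ) · E[f(x + δ r u) k(r) u], where u is uniformly distributed on the Euclidean unit sphere of ℝ^d and r is independent of u and uniformly distributed on [−1,1]. -/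
open MeasureTheory Metric

/-- The uniform probability distribution on the interval `[-1, 1] ⊆ ℝ`. -/
noncomputable def intervalUniform : Measure ℝ :=
  (2 : ENNReal)⁻¹ • (volume.restrict (Set.Icc (-1 : ℝ) 1))

/-- The uniform probability distribution on the closed Euclidean unit ball of `ℝ^d`. -/
noncomputable def ballUniform (d : ℕ) : Measure (EuclideanSpace ℝ (Fin d)) :=
  (volume (closedBall (0 : EuclideanSpace ℝ (Fin d)) 1))⁻¹ •
    (volume.restrict (closedBall (0 : EuclideanSpace ℝ (Fin d)) 1))

/-- The uniform probability distribution (normalized surface measure) on the Euclidean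
unit sphere of `ℝ^d`, viewed as a measure on `ℝ^d`. -/
noncomputable def sphereUniform (d : ℕ) : Measure (EuclideanSpace ℝ (Fin d)) :=
  ((volume : Measure (EuclideanSpace ℝ (Fin d))).toSphere Set.univ)⁻¹ •
    ((volume : Measure (EuclideanSpace ℝ (Fin d))).toSphere.map Subtype.val)

/-- The smoothed version `f̂_δ` of `f : ℝ^d → ℝ`:
`f̂_δ(x) = E[f(x + r δ v) r k(r)]` where `r` is uniform on `[-1,1]` and `v` is independent
of `r`, uniform on the closed unit ball. -/
noncomputable def smoothed (d : ℕ) (f : EuclideanSpace ℝ (Fin d) → ℝ) (δ : ℝ) (k : ℝ → ℝ)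
    (x : EuclideanSpace ℝ (Fin d)) : ℝ :=
  ∫ p : ℝ × EuclideanSpace ℝ (Fin d), f (x + (p.1 * δ) • p.2) * (p.1 * k p.1)
    ∂(intervalUniform.prod (ballUniform d))

open scoped Topology NNReal
open Filter Set

theorem polar_integral {E : Type*} [NormedAddCommGroup E] [NormedSpace ℝ E] [MeasurableSpace E]
    [BorelSpace E] [FiniteDimensional ℝ E] [Nontrivial E] (μ : Measure E) [μ.IsAddHaarMeasure]
    (G : E → ℝ) (hG : Integrable G μ) :
    ∫ x, G x ∂μ = ∫ t in Ioi (0:ℝ), t ^ (Module.finrank ℝ E - 1) *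
      ∫ u : sphere (0:E) 1, G (t • (u : E)) ∂μ.toSphere := by
  have mp := μ.measurePreserving_homeomorphUnitSphereProd
  have e1 : ∫ x, G x ∂μ = ∫ x : ({(0)}ᶜ : Set E), G x.1 ∂(μ.comap (↑)) := by
    rw [integral_subtype_comap (measurableSet_singleton _).compl G, restrict_compl_singleton]
  have hGcomap : Integrable (fun x : ({(0)}ᶜ : Set E) => G x.1) (μ.comap (↑)) := by
    have := (integrableOn_iff_comap_subtypeVal (μ := μ) (f := G)
      (measurableSet_singleton (0:E)).compl).1 hG.integrableOn
    exact this
  let g : sphere (0:E) 1 × Ioi (0:ℝ) → ℝ := fun p => G ((p.2 : ℝ) • (p.1 : E))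
  have hg : ∀ x : ({(0)}ᶜ : Set E), g (homeomorphUnitSphereProd E x) = G x.1 := by
    intro x
    simp only [g]
    congr 1
    have : ‖(x:E)‖ ≠ 0 := norm_ne_zero_iff.2 x.2
    simp [smul_smul, this]
  have hgint : Integrable g (μ.toSphere.prod (Measure.volumeIoiPow (Module.finrank ℝ E - 1))) := by
    rw [← mp.integrable_comp_emb (Homeomorph.measurableEmbedding _)]
    refine hGcomap.congr (.of_forall fun x => (hg x).symm)
  rw [e1]
  simp_rw [← hg]
  rw [mp.integral_comp (Homeomorph.measurableEmbedding _) g, integral_prod_symm _ hgint,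
    Measure.volumeIoiPow]
  simp only [ENNReal.ofReal]
  rw [integral_withDensity_eq_integral_smul]
  · rw [← integral_subtype_comap measurableSet_Ioi fun a : ℝ => a ^ (Module.finrank ℝ E - 1) *
      ∫ u : sphere (0:E) 1, G (a • (u : E)) ∂μ.toSphere]
    refine integral_congr_ae (.of_forall ?_)
    rintro ⟨a, ha⟩
    simp only [g, NNReal.smul_def, smul_eq_mul]
    rw [Real.coe_toNNReal _ (pow_nonneg (le_of_lt ha) _)]
  · exact (measurable_subtype_coe.pow_const _).real_toNNReal

noncomputable def cut (ε t : ℝ) : ℝ := max 0 (min 1 (1 + (1 - t) / ε))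

theorem cut_lip {E : Type*} [NormedAddCommGroup E] (ε : ℝ) (hε : 0 < ε) :
    LipschitzWith (Real.toNNReal ε⁻¹) (fun v : E => cut ε ‖v‖) := by
  unfold cut
  refine LipschitzWith.const_max (LipschitzWith.const_min ?_ _) _
  refine LipschitzWith.of_dist_le_mul fun v w => ?_
  rw [Real.coe_toNNReal _ (by positivity), Real.dist_eq, dist_eq_norm]
  have : 1 + (1 - ‖v‖) / ε - (1 + (1 - ‖w‖) / ε) = ε⁻¹ * (‖w‖ - ‖v‖) := by
    field_simp; ring
  rw [this, abs_mul, abs_of_pos (by positivity : 0 < ε⁻¹), norm_sub_rev]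
  gcongr
  exact abs_norm_sub_norm_le _ _

theorem cut_supp {ε t : ℝ} (hε : 0 < ε) (ht : 1 + ε ≤ t) : cut ε t = 0 := by
  unfold cut
  have : (1 - t) / ε ≤ -1 := by rw [div_le_iff₀ hε]; linarith
  rw [max_eq_left]
  exact (min_le_right _ _).trans (by linarith)

theorem cut_one {ε t : ℝ} (hε : 0 < ε) (ht : t ≤ 1) : cut ε t = 1 := by
  unfold cut
  have : 0 ≤ (1 - t) / ε := by apply div_nonneg <;> linarith
  rw [min_eq_left (by linarith)]; simp

theorem cut_mid {ε t : ℝ} (hε : 0 < ε) (h1 : 1 ≤ t) (ht : t ≤ 1 + ε) :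
    cut ε t = 1 + (1 - t) / ε := by
  unfold cut
  have : (1 - t) / ε ≤ 0 := by apply div_nonpos_of_nonpos_of_nonneg <;> linarith
  have : -1 ≤ (1 - t) / ε := by rw [le_div_iff₀ hε]; linarith
  rw [min_eq_right (by linarith), max_eq_right (by linarith)]

theorem cut_nonneg (ε t : ℝ) : 0 ≤ cut ε t := le_max_left _ _
theorem cut_le_one (ε t : ℝ) : cut ε t ≤ 1 := max_le zero_le_one (min_le_left _ _)

theorem cut_hasDerivAt {ε t : ℝ} (hε : 0 < ε) (h1 : t ≠ 1) (h2 : t ≠ 1 + ε) :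
    HasDerivAt (cut ε) ((Ioc 1 (1 + ε)).indicator (fun _ => -ε⁻¹) t) t := by
  rcases lt_or_gt_of_ne h1 with h | h
  · rw [indicator_of_notMem (by simp; intro h'; linarith)]
    refine (hasDerivAt_const t (1:ℝ)).congr_of_eventuallyEq ?_
    filter_upwards [Iio_mem_nhds h] with s hs using cut_one hε (le_of_lt hs)
  · rcases lt_or_gt_of_ne h2 with h' | h'
    · rw [indicator_of_mem (by exact ⟨h, h'.le⟩)]
      have : HasDerivAt (fun s => 1 + (1 - s) / ε) (-ε⁻¹) t := by
        have := (((hasDerivAt_id t).const_sub 1).div_const ε).const_add 1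
        simpa [neg_div] using this
      refine this.congr_of_eventuallyEq ?_
      filter_upwards [Ioo_mem_nhds h h'] with s hs using cut_mid hε hs.1.le hs.2.le
    · rw [indicator_of_notMem (by simp; intro _; linarith)]
      refine (hasDerivAt_const t (0:ℝ)).congr_of_eventuallyEq ?_
      filter_upwards [Ioi_mem_nhds h'] with s hs using cut_supp hε (le_of_lt hs)

theorem cut_lineDeriv {E : Type*} [NormedAddCommGroup E] [InnerProductSpace ℝ E] {ε t : ℝ}
    (hε : 0 < ε) (h0 : 0 < t) (h1 : t ≠ 1) (h2 : t ≠ 1 + ε) (u e : E) (hu : ‖u‖ = 1) :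
    lineDeriv ℝ (fun v : E => cut ε ‖v‖) (t • u) (-e)
      = (Ioc 1 (1 + ε)).indicator (fun _ => ε⁻¹) t * inner ℝ u e := by
  have hn : ‖t • u‖ = t := by rw [norm_smul, hu, Real.norm_of_nonneg h0.le, mul_one]
  have A : HasDerivAt (fun s : ℝ => t • u + s • (-e)) (-e) 0 := by
    simpa using ((hasDerivAt_id (0:ℝ)).smul_const (-e)).const_add (t • u)
  have B := A.norm_sq.sqrt (by simp [hn, h0.ne'])
  have C : HasDerivAt (fun s : ℝ => ‖t • u + s • (-e)‖) (- inner ℝ u e) 0 := by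
    convert! B using 1
    · ext s; simp
    · simp [hn, inner_smul_left, h0.le]; field_simp
  have D : HasDerivAt (cut ε) ((Ioc 1 (1 + ε)).indicator (fun _ => -ε⁻¹) t)
      (‖t • u + (0:ℝ) • (-e)‖) := by
    simp only [zero_smul, add_zero, hn]
    exact cut_hasDerivAt hε h1 h2
  have := (D.comp (0:ℝ) C).deriv
  unfold lineDeriv
  refine this.trans ?_
  by_cases h : t ∈ Ioc 1 (1 + ε)
  · simp [indicator_of_mem h]
  · simp [indicator_of_notMem h]

theorem ball_sphere {E : Type*} [NormedAddCommGroup E] [InnerProductSpace ℝ E] [MeasurableSpace E]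
    [BorelSpace E] [FiniteDimensional ℝ E] [Nontrivial E] (μ : Measure E) [μ.IsAddHaarMeasure]
    (h : E → ℝ) (K : ℝ≥0) (hh : LipschitzWith K h) (e : E) :
    ∫ v in closedBall (0:E) 1, lineDeriv ℝ h v e ∂μ =
      ∫ u : sphere (0:E) 1, h u * inner ℝ (u:E) e ∂μ.toSphere := by
  set q : ℝ → ℝ := fun t => ∫ u : sphere (0:E) 1, h (t • (u:E)) * inner ℝ (u:E) e ∂μ.toSphere
  have hcont := hh.continuous
  have hq : Continuous q := by
    have := continuous_parametric_integral_of_continuous (μ := μ.toSphere) (s := univ)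
      (f := fun (t : ℝ) (u : sphere (0:E) 1) => h (t • (u:E)) * inner ℝ (u:E) e)
      (by unfold Function.uncurry; fun_prop) isCompact_univ
    simpa [q] using this
  set n := Module.finrank ℝ E - 1
  have hsupp : ∀ ε > 0, HasCompactSupport (fun v : E => cut ε ‖v‖) := by
    intro ε hε
    refine HasCompactSupport.intro (isCompact_closedBall (0:E) (1 + ε)) fun x hx => ?_
    simp at hx
    exact cut_supp hε hx.le
  have ibp : ∀ ε > 0, ∫ v, lineDeriv ℝ h v e * cut ε ‖v‖ ∂μ
      = ε⁻¹ * ∫ t in (1:ℝ)..(1 + ε), t ^ n * q t := by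
    intro ε hε
    rw [hh.integral_lineDeriv_mul_eq (cut_lip ε hε) (hsupp ε hε), polar_integral]
    · rw [intervalIntegral.integral_of_le (by linarith), ← integral_const_mul,
        ← integral_indicator measurableSet_Ioc, ← integral_indicator measurableSet_Ioi]
      apply integral_congr_ae
      have c1 : ∀ᵐ t : ℝ, t ≠ 1 := by simp [ae_iff, measure_singleton]
      have c2 : ∀ᵐ t : ℝ, t ≠ 1 + ε := by simp [ae_iff, measure_singleton]
      filter_upwards [c1, c2] with t h1 h2
      by_cases h0 : 0 < t
      · rw [indicator_of_mem (by exact h0)]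
        have : ∀ u : sphere (0:E) 1, lineDeriv ℝ (fun v : E => cut ε ‖v‖) (t • (u:E)) (-e) *
            h (t • (u:E)) = (Ioc 1 (1 + ε)).indicator (fun _ => ε⁻¹) t *
              (h (t • (u:E)) * inner ℝ (u:E) e) := by
          intro u
          rw [cut_lineDeriv hε h0 h1 h2 _ _ (by simp)]
          ring
        simp_rw [this]
        rw [integral_const_mul]
        by_cases ht : t ∈ Ioc 1 (1 + ε)
        · simp only [indicator_of_mem ht]; simp only [q, n]; ring
        · simp [indicator_of_notMem ht]
      · rw [indicator_of_notMem (by exact h0), indicator_of_notMem]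
        intro hh; exact h0 (by linarith [hh.1])
    · have hb : ∀ x ∉ closedBall (0:E) (1+ε),
          lineDeriv ℝ (fun v : E => cut ε ‖v‖) x (-e) * h x = 0 := by
        intro x hx
        have : lineDeriv ℝ (fun v : E => cut ε ‖v‖) x (-e) = 0 := by
          have hx' : (closedBall (0:E) (1+ε))ᶜ ∈ 𝓝 x := isClosed_closedBall.isOpen_compl.mem_nhds hx
          have : (fun v : E => cut ε ‖v‖) =ᶠ[𝓝 x] fun _ => 0 := by
            filter_upwards [hx'] with y hy
            simp at hy
            exact cut_supp hε hy.le
          rw [this.lineDeriv_eq]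
          simp [lineDeriv]
        rw [this, zero_mul]
      rw [← integrableOn_iff_integrable_of_support_subset (s := closedBall (0:E) (1+ε))]
      · exact (((cut_lip ε hε).locallyIntegrable_lineDeriv (-e)).integrableOn_isCompact
          (isCompact_closedBall _ _)).mul_continuousOn hcont.continuousOn (isCompact_closedBall _ _)
      · intro x hx
        by_contra hc
        exact hx (hb x hc)
  have lim1 : Tendsto (fun ε : ℝ => ∫ v, lineDeriv ℝ h v e * cut ε ‖v‖ ∂μ) (𝓝[>] 0)
      (𝓝 (∫ v in closedBall (0:E) 1, lineDeriv ℝ h v e ∂μ)) := by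
    rw [← integral_indicator measurableSet_closedBall]
    apply tendsto_integral_filter_of_dominated_convergence
      ((closedBall (0:E) 2).indicator fun _ => K * ‖e‖)
    · filter_upwards [self_mem_nhdsWithin] with ε hε
      exact ((measurable_lineDeriv hcont).mul (cut_lip ε hε).continuous.measurable).aestronglyMeasurable
    · filter_upwards [Ioo_mem_nhdsGT (zero_lt_one' ℝ)] with ε hε
      refine .of_forall fun v => ?_
      by_cases hv : v ∈ closedBall (0:E) 2
      · rw [indicator_of_mem hv, norm_mul, ← mul_one (K * ‖e‖)]
        gcongr
        · exact norm_lineDeriv_le_of_lipschitz ℝ hh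
        · rw [Real.norm_of_nonneg (cut_nonneg _ _)]; exact cut_le_one _ _
      · rw [indicator_of_notMem hv]
        simp at hv
        rw [cut_supp hε.1 (by linarith [hε.2])]; simp
    · rw [integrable_indicator_iff measurableSet_closedBall]
      exact integrableOn_const measure_closedBall_lt_top.ne
    · refine .of_forall fun v => ?_
      by_cases hv : v ∈ closedBall (0:E) 1
      · rw [indicator_of_mem hv]
        refine tendsto_const_nhds.congr' ?_
        filter_upwards [self_mem_nhdsWithin] with ε hε
        rw [cut_one hε (by simpa using hv), mul_one]
      · rw [indicator_of_notMem hv]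
        simp at hv
        refine tendsto_const_nhds.congr' ?_
        filter_upwards [Ioo_mem_nhdsGT (sub_pos.2 hv)] with ε hε
        rw [cut_supp hε.1 (by linarith [hε.2]), mul_zero]
  have lim2 : Tendsto (fun ε : ℝ => ε⁻¹ * ∫ t in (1:ℝ)..(1 + ε), t ^ n * q t) (𝓝[>] 0)
      (𝓝 (q 1)) := by
    have hc : Continuous fun t => t ^ n * q t := by fun_prop
    have := (hc.integral_hasStrictDerivAt 1 1).hasDerivAt
    have := this.tendsto_slope_zero_right
    simpa using this
  have := tendsto_nhds_unique (lim1.congr' (by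
    filter_upwards [self_mem_nhdsWithin] with ε hε using ibp ε hε)) lim2
  rw [this]; simp [q]

instance ballUniform_finite (d : ℕ) : IsFiniteMeasure (ballUniform d) := by
  refine ⟨?_⟩
  unfold ballUniform
  rw [Measure.smul_apply, Measure.restrict_apply_univ, smul_eq_mul]
  exact (ENNReal.inv_mul_le_one _).trans_lt ENNReal.one_lt_top

instance sphereUniform_finite (d : ℕ) : IsFiniteMeasure (sphereUniform d) := by
  refine ⟨?_⟩
  unfold sphereUniform
  rw [Measure.smul_apply, Measure.map_apply measurable_subtype_coe MeasurableSet.univ, smul_eq_mul,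
    preimage_univ]
  exact (ENNReal.inv_mul_le_one _).trans_lt ENNReal.one_lt_top

instance intervalUniform_finite : IsFiniteMeasure intervalUniform := by
  refine ⟨?_⟩
  unfold intervalUniform
  rw [Measure.smul_apply, Measure.restrict_apply_univ, smul_eq_mul]
  simp
  exact ENNReal.mul_lt_top (by simp) (by norm_num)

theorem ae_interval : ∀ᵐ r ∂intervalUniform, r ∈ Icc (-1:ℝ) 1 := by
  unfold intervalUniform
  exact Measure.ae_smul_measure (ae_restrict_mem measurableSet_Icc) _

theorem ae_interval_ne : ∀ᵐ r ∂intervalUniform, r ≠ 0 := by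
  unfold intervalUniform
  refine Measure.ae_smul_measure (ae_restrict_of_ae ?_) _
  simp [ae_iff, measure_singleton]

theorem ae_ball (d : ℕ) : ∀ᵐ v ∂ballUniform d, ‖v‖ ≤ 1 := by
  unfold ballUniform
  refine Measure.ae_smul_measure ?_ _
  filter_upwards [ae_restrict_mem measurableSet_closedBall] with v hv
  simpa using hv

theorem ae_sphere (d : ℕ) : ∀ᵐ v ∂sphereUniform d, ‖v‖ = 1 := by
  unfold sphereUniform
  refine Measure.ae_smul_measure ?_ _
  rw [ae_map_iff measurable_subtype_coe.aemeasurable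
    (measurableSet_eq_fun measurable_norm measurable_const)]
  exact .of_forall fun u => by simp

theorem ball_ac (d : ℕ) {p : EuclideanSpace ℝ (Fin d) → Prop} (h : ∀ᵐ v, p v) :
    ∀ᵐ v ∂ballUniform d, p v := by
  unfold ballUniform
  exact Measure.ae_smul_measure (ae_restrict_of_ae h) _

theorem avg (d : ℕ) (hd : 1 ≤ d) (h : EuclideanSpace ℝ (Fin d) → ℝ) (K : ℝ≥0)
    (hh : LipschitzWith K h) (e : EuclideanSpace ℝ (Fin d)) :
    ∫ v, lineDeriv ℝ h v e ∂ballUniform d = d * ∫ u, h u * inner ℝ u e ∂sphereUniform d := by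
  have : Nonempty (Fin d) := ⟨⟨0, hd⟩⟩
  have hd0 : (d:ℝ) ≠ 0 := by positivity
  unfold ballUniform sphereUniform
  rw [integral_smul_measure, integral_smul_measure,
    (MeasurableEmbedding.subtype_coe isClosed_sphere.measurableSet).integral_map,
    ball_sphere _ h K hh, Measure.toSphere_apply_univ, Measure.addHaar_closedBall_eq_addHaar_ball]
  simp only [finrank_euclideanSpace, Fintype.card_fin, ENNReal.toReal_inv, ENNReal.toReal_mul,
    ENNReal.toReal_natCast, smul_eq_mul, mul_inv]
  field_simp

theorem smoothed_lip (d : ℕ) (hd : 1 ≤ d) (f : EuclideanSpace ℝ (Fin d) → ℝ) (K : ℝ≥0)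
    (hf : LipschitzWith K f) (δ : ℝ) (hδ : 0 < δ)
    (k : ℝ → ℝ) (hkmeas : Measurable k) (hkbdd : ∃ C, ∀ r ∈ Set.Icc (-1 : ℝ) 1, |k r| ≤ C)
    (x : EuclideanSpace ℝ (Fin d)) :
      HasGradientAt (smoothed d f δ k)
        (((d : ℝ) / δ) •
          ∫ p : ℝ × EuclideanSpace ℝ (Fin d), (f (x + (δ * p.1) • p.2) * k p.1) • p.2
            ∂(intervalUniform.prod (sphereUniform d))) x := by
  obtain ⟨C, hC⟩ := hkbdd
  have hC0 : 0 ≤ C := (abs_nonneg _).trans (hC 0 (by simp))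
  have hcont := hf.continuous
  have aeB : ∀ᵐ p ∂(intervalUniform.prod (ballUniform d)),
      p.1 ∈ Icc (-1:ℝ) 1 ∧ ‖p.2‖ ≤ 1 :=
    (Measure.quasiMeasurePreserving_fst.ae ae_interval).and
      (Measure.quasiMeasurePreserving_snd.ae (ae_ball d))
  have aeS : ∀ᵐ p ∂(intervalUniform.prod (sphereUniform d)),
      p.1 ∈ Icc (-1:ℝ) 1 ∧ ‖p.2‖ = 1 :=
    (Measure.quasiMeasurePreserving_fst.ae ae_interval).and
      (Measure.quasiMeasurePreserving_snd.ae (ae_sphere d))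
  have hbd : ∀ (r : ℝ) (v : EuclideanSpace ℝ (Fin d)), r ∈ Icc (-1:ℝ) 1 → ‖v‖ ≤ 1 →
      |f (x + (δ * r) • v)| ≤ |f x| + K * δ := by
    intro r v hr hv
    have h1 := hf.dist_le_mul (x + (δ * r) • v) x
    have h2 : dist (x + (δ * r) • v) x ≤ δ := by
      rw [dist_eq_norm, add_sub_cancel_left, norm_smul, norm_mul, Real.norm_of_nonneg hδ.le,
        Real.norm_eq_abs]
      have : |r| ≤ 1 := abs_le.2 hr
      calc δ * |r| * ‖v‖ ≤ δ * 1 * 1 := by gcongr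
        _ = δ := by ring
    have h3 : (K:ℝ) * dist (x + (δ * r) • v) x ≤ K * δ := by gcongr
    rw [Real.dist_eq] at h1
    have := abs_sub_abs_le_abs_sub (f (x + (δ * r) • v)) (f x)
    linarith
  have hrk : ∀ r ∈ Icc (-1:ℝ) 1, |r * k r| ≤ C := by
    intro r hr
    rw [abs_mul]
    calc |r| * |k r| ≤ 1 * C := by
          gcongr
          · exact abs_le.2 hr
          · exact hC r hr
      _ = C := one_mul C
  let F' : ℝ × EuclideanSpace ℝ (Fin d) → (EuclideanSpace ℝ (Fin d) →L[ℝ] ℝ) :=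
    fun p => (p.1 * k p.1) • fderiv ℝ f (x + (p.1 * δ) • p.2)
  have hmap : Measurable fun p : ℝ × EuclideanSpace ℝ (Fin d) => x + (p.1 * δ) • p.2 :=
    Continuous.measurable (by fun_prop)
  have hdiff0 : ∀ r : ℝ, r ≠ 0 → ∀ᵐ v : EuclideanSpace ℝ (Fin d),
      DifferentiableAt ℝ f (x + (r * δ) • v) := by
    intro r hr
    have hq : Measure.QuasiMeasurePreserving
        (fun v : EuclideanSpace ℝ (Fin d) => x + (r * δ) • v) volume volume := by
      have h1 : Measure.QuasiMeasurePreserving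
        (fun v : EuclideanSpace ℝ (Fin d) => (r * δ) • v) volume volume := by
        refine ⟨by fun_prop, ?_⟩
        rw [Measure.map_addHaar_smul _ (mul_ne_zero hr hδ.ne')]
        exact Measure.smul_absolutelyContinuous
      exact (measurePreserving_add_left volume x).quasiMeasurePreserving.comp h1
    exact hq.ae hf.ae_differentiableAt
  have hdiff : ∀ᵐ p ∂(intervalUniform.prod (ballUniform d)),
      DifferentiableAt ℝ f (x + (p.1 * δ) • p.2) := by
    refine (Measure.ae_prod_iff_ae_ae (hmap (measurableSet_of_differentiableAt ℝ f))).2 ?_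
    filter_upwards [ae_interval_ne] with r hr
    exact ball_ac d (hdiff0 r hr)
  have hF'meas : Measurable F' := by
    have : Measurable fun p : ℝ × EuclideanSpace ℝ (Fin d) => p.1 * k p.1 := by fun_prop
    exact this.smul ((measurable_fderiv ℝ f).comp hmap)
  have main := hasFDerivAt_integral_of_dominated_loc_of_lip
    (μ := intervalUniform.prod (ballUniform d)) (𝕜 := ℝ) (x₀ := x) (s := univ)
    (F := fun y p => f (y + (p.1 * δ) • p.2) * (p.1 * k p.1)) (F' := F') (bound := fun _ => C * K)
    univ_mem ?_ ?_ hF'meas.aestronglyMeasurable ?_ (integrable_const _) ?_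
  rotate_left
  · refine .of_forall fun y => Measurable.aestronglyMeasurable ?_
    have : Measurable fun p : ℝ × EuclideanSpace ℝ (Fin d) => f (y + (p.1 * δ) • p.2) :=
      Continuous.measurable (by fun_prop)
    fun_prop
  · refine Integrable.of_bound (C := (|f x| + K * δ) * C) (Measurable.aestronglyMeasurable ?_) ?_
    · have : Measurable fun p : ℝ × EuclideanSpace ℝ (Fin d) => f (x + (p.1 * δ) • p.2) :=
        Continuous.measurable (by fun_prop)
      fun_prop
    · filter_upwards [aeB] with p hp
      rw [norm_mul]
      gcongr
      · rw [mul_comm p.1]; exact hbd _ _ hp.1 hp.2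
      · exact hrk _ hp.1
  · filter_upwards [aeB] with p hp
    refine LipschitzOnWith.of_dist_le_mul fun y _ z _ => ?_
    have h1 := hf.dist_le_mul (y + (p.1 * δ) • p.2) (z + (p.1 * δ) • p.2)
    rw [dist_add_right] at h1
    have hCK : |C * (K:ℝ)| = C * K := abs_of_nonneg (by positivity)
    rw [Real.dist_eq, ← sub_mul, abs_mul, ← Real.dist_eq, Real.coe_nnabs, hCK]
    calc _ ≤ (K * dist y z) * C := by
          gcongr
          exact hrk _ hp.1
      _ = _ := by ring
  · filter_upwards [hdiff] with p hp
    have := (hp.hasFDerivAt.comp x ((hasFDerivAt_id x).add_const ((p.1 * δ) • p.2))).mul_const (p.1 * k p.1)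
    exact this
  obtain ⟨hF'int, hder⟩ := main
  rw [hasGradientAt_iff_hasFDerivAt]
  have hSint : Integrable (fun p : ℝ × EuclideanSpace ℝ (Fin d) =>
      (f (x + (δ * p.1) • p.2) * k p.1) • p.2) (intervalUniform.prod (sphereUniform d)) := by
    refine Integrable.of_bound (C := (|f x| + K * δ) * C) (Measurable.aestronglyMeasurable ?_) ?_
    · have : Measurable fun p : ℝ × EuclideanSpace ℝ (Fin d) => f (x + (δ * p.1) • p.2) :=
        Continuous.measurable (by fun_prop)
      fun_prop
    · filter_upwards [aeS] with p hp
      rw [norm_smul, norm_mul, hp.2, mul_one]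
      gcongr
      · exact hbd _ _ hp.1 hp.2.le
      · exact hC _ hp.1
  have key : (InnerProductSpace.toDual ℝ (EuclideanSpace ℝ (Fin d))) (((d : ℝ) / δ) •
          ∫ p : ℝ × EuclideanSpace ℝ (Fin d), (f (x + (δ * p.1) • p.2) * k p.1) • p.2
            ∂(intervalUniform.prod (sphereUniform d)))
      = ∫ p, F' p ∂(intervalUniform.prod (ballUniform d)) := by
    refine ContinuousLinearMap.ext fun e => ?_
    rw [InnerProductSpace.toDual_apply_apply, ContinuousLinearMap.integral_apply hF'int,
      real_inner_smul_left, real_inner_comm, ← integral_inner hSint,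
      integral_prod _ (hF'int.apply_continuousLinearMap e), integral_prod _ (hSint.const_inner e),
      ← integral_const_mul]
    apply integral_congr_ae
    filter_upwards [ae_interval_ne] with r hr
    have hlip : LipschitzWith (K * ‖r * δ‖₊) (fun v => f (x + (r * δ) • v)) := by
      refine LipschitzWith.of_dist_le_mul fun v w => ?_
      refine (hf.dist_le_mul _ _).trans ?_
      rw [dist_add_left, dist_smul₀]
      simp [mul_assoc]
    have hav := avg d hd _ _ hlip e
    have e1 : ∫ v, (F' (r, v)) e ∂ballUniform d =
        ∫ v, (k r / δ) * lineDeriv ℝ (fun v => f (x + (r * δ) • v)) v e ∂ballUniform d := by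
      apply integral_congr_ae
      filter_upwards [ball_ac d (hdiff0 r hr)] with v hv
      have h1 : HasFDerivAt (fun v : EuclideanSpace ℝ (Fin d) => x + (r * δ) • v)
          ((r * δ) • ContinuousLinearMap.id ℝ _) v :=
        ((hasFDerivAt_id v).const_smul (r * δ)).const_add x
      have h2 := (hv.hasFDerivAt.comp v h1).hasLineDerivAt e
      have h3 := h2.lineDeriv
      have h4 : lineDeriv ℝ (fun v => f (x + (r * δ) • v)) v e
        = (r * δ) * fderiv ℝ f (x + (r * δ) • v) e := by
        refine h3.trans ?_
        simp
      simp only [F', h4, smul_apply, smul_eq_mul]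
      field_simp
    rw [e1, integral_const_mul, hav, ← integral_const_mul, ← integral_const_mul,
      ← integral_const_mul]
    congr 1
    ext u
    rw [real_inner_smul_right, real_inner_comm, mul_comm δ r]
    ring
  rw [key]
  exact hder

theorem stmt_1 (d : ℕ) (hd : 1 ≤ d) (f : EuclideanSpace ℝ (Fin d) → ℝ)
    (hconv : ConvexOn ℝ Set.univ f) (δ : ℝ) (hδ : 0 < δ)
    (k : ℝ → ℝ) (hkmeas : Measurable k) (hkbdd : ∃ C, ∀ r ∈ Set.Icc (-1 : ℝ) 1, |k r| ≤ C) :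
    ∀ x : EuclideanSpace ℝ (Fin d),
      HasGradientAt (smoothed d f δ k)
        (((d : ℝ) / δ) •
          ∫ p : ℝ × EuclideanSpace ℝ (Fin d), (f (x + (δ * p.1) • p.2) * k p.1) • p.2
            ∂(intervalUniform.prod (sphereUniform d))) x := by
  intro x
  obtain ⟨K, hK⟩ := LocallyLipschitzOn.exists_lipschitzOnWith_of_compact
    (isCompact_closedBall x (1 + δ)) hconv.locallyLipschitz.locallyLipschitzOn
  obtain ⟨g, hg, hfg⟩ := hK.extend_real
  have h := smoothed_lip d hd g K hg δ hδ k hkmeas hkbdd x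
  have aeB : ∀ᵐ p ∂(intervalUniform.prod (ballUniform d)),
      p.1 ∈ Icc (-1:ℝ) 1 ∧ ‖p.2‖ ≤ 1 :=
    (Measure.quasiMeasurePreserving_fst.ae ae_interval).and
      (Measure.quasiMeasurePreserving_snd.ae (ae_ball d))
  have aeS : ∀ᵐ p ∂(intervalUniform.prod (sphereUniform d)),
      p.1 ∈ Icc (-1:ℝ) 1 ∧ ‖p.2‖ = 1 :=
    (Measure.quasiMeasurePreserving_fst.ae ae_interval).and
      (Measure.quasiMeasurePreserving_snd.ae (ae_sphere d))
  have hbd : ∀ (r : ℝ) (y v : EuclideanSpace ℝ (Fin d)), y ∈ ball x 1 → r ∈ Icc (-1:ℝ) 1 →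
      ‖v‖ ≤ 1 → f (y + (δ * r) • v) = g (y + (δ * r) • v) := by
    intro r y v hy hr hv
    apply hfg
    have h2 : ‖(δ * r) • v‖ ≤ δ := by
      rw [norm_smul, norm_mul, Real.norm_of_nonneg hδ.le, Real.norm_eq_abs]
      have : |r| ≤ 1 := abs_le.2 hr
      calc δ * |r| * ‖v‖ ≤ δ * 1 * 1 := by gcongr
        _ = δ := by ring
    rw [mem_ball, dist_eq_norm] at hy
    rw [mem_closedBall, dist_eq_norm, add_sub_right_comm]
    exact (norm_add_le _ _).trans (add_le_add hy.le h2)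
  have e1 : ∫ p : ℝ × EuclideanSpace ℝ (Fin d), (f (x + (δ * p.1) • p.2) * k p.1) • p.2
            ∂(intervalUniform.prod (sphereUniform d)) =
      ∫ p : ℝ × EuclideanSpace ℝ (Fin d), (g (x + (δ * p.1) • p.2) * k p.1) • p.2
            ∂(intervalUniform.prod (sphereUniform d)) := by
    apply integral_congr_ae
    filter_upwards [aeS] with p hp
    rw [hbd _ _ _ (mem_ball_self one_pos) hp.1 hp.2.le]
  have e2 : smoothed d f δ k =ᶠ[𝓝 x] smoothed d g δ k := by
    filter_upwards [ball_mem_nhds x one_pos] with y hy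
    unfold smoothed
    apply integral_congr_ae
    filter_upwards [aeB] with p hp
    rw [mul_comm p.1 δ, hbd _ _ _ hy hp.1 hp.2]
  rw [e1]
  exact HasGradientAt.congr_of_eventuallyEq h e2
end

section
/- Let (p_m)_{m≥0} be the orthonormal polynomials for the uniform distribution on [−1,1], let β ≥ 1 be an integer, and define k(r) = Σ_{m=0}^{β} p_m'(0) p_m(r). Then, for r uniformly distributed on [−1,1]: E_r[k(r)²] ≤ 3 β³, E_r[k(r)² r²] ≤ 8 β², and E_r[|k(r) r^{β+1}|] ≤ 2√2 β. -/
open MeasureTheory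

/-- `p` is the sequence of orthonormal polynomials for the uniform distribution on `[-1,1]`:
`p m` has degree `m` and positive leading coefficient, and the family is orthonormal in
`L²` of the uniform distribution on `[-1,1]`. -/
def IsLegendreONB (p : ℕ → Polynomial ℝ) : Prop :=
  (∀ m, (p m).degree = m) ∧ (∀ m, 0 < (p m).leadingCoeff) ∧
    ∀ m m', (1 / 2 : ℝ) * ∫ r in (-1 : ℝ)..1, (p m).eval r * (p m').eval r =
      if m = m' then 1 else 0

/-- Expectation of a polynomial under the uniform distribution. -/
noncomputable def EE : Polynomial ℝ →ₗ[ℝ] ℝ where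
  toFun f := (1 / 2 : ℝ) * ∫ r in (-1 : ℝ)..1, f.eval r
  map_add' f g := by
    simp only [Polynomial.eval_add]
    rw [intervalIntegral.integral_add (f.continuous.intervalIntegrable _ _)
      (g.continuous.intervalIntegrable _ _)]
    ring
  map_smul' c f := by
    simp only [Polynomial.eval_smul, smul_eq_mul, intervalIntegral.integral_const_mul, RingHom.id_apply]
    ring

namespace LegAux
open Polynomial

lemma EE_apply (f : ℝ[X]) : EE f = (1 / 2 : ℝ) * ∫ r in (-1 : ℝ)..1, f.eval r := rfl

lemma EE_C_mul (c : ℝ) (f : ℝ[X]) : EE (C c * f) = c * EE f := by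
  rw [← smul_eq_C_mul, map_smul, smul_eq_mul]

lemma EE_neg_comp (f : ℝ[X]) : EE (f.comp (-X)) = EE f := by
  rw [EE_apply, EE_apply]
  congr 1
  have := intervalIntegral.integral_comp_neg (a := -1) (b := 1) (fun r => f.eval r)
  simpa using this

lemma EE_deriv (f : ℝ[X]) : EE (derivative f) = (f.eval 1 - f.eval (-1)) / 2 := by
  rw [EE_apply, intervalIntegral.integral_eq_sub_of_hasDerivAt (f := fun r => f.eval r)]
  · ring
  · intro x _
    exact f.hasDerivAt x
  · exact (derivative f).continuous.intervalIntegrable _ _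

lemma orth {p : ℕ → ℝ[X]} (hp : IsLegendreONB p) (m n : ℕ) : EE (p m * p n) = if m = n then 1 else 0 := by
  rw [← hp.2.2 m n, EE_apply]
  simp

lemma lc {p : ℕ → ℝ[X]} (hp : IsLegendreONB p) (n : ℕ) : 0 < (p n).coeff n := by
  have h := hp.2.1 n
  rwa [leadingCoeff, natDegree_eq_of_degree_eq_some (hp.1 n)] at h

lemma coeff_big {p : ℕ → ℝ[X]} (hp : IsLegendreONB p) {n m : ℕ} (h : n < m) : (p n).coeff m = 0 :=
  coeff_eq_zero_of_degree_lt (by rw [hp.1 n]; exact_mod_cast h)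

lemma expand {p : ℕ → ℝ[X]} (hp : IsLegendreONB p) (n : ℕ) : ∀ q : ℝ[X], (∀ m, n ≤ m → q.coeff m = 0) →
    ∃ d : ℕ → ℝ, q = ∑ j ∈ Finset.range n, C (d j) * p j := by
  induction n with
  | zero =>
    intro q hq
    refine ⟨fun _ => 0, ?_⟩
    ext m
    simpa using hq m (Nat.zero_le _)
  | succ n ih =>
    intro q hq
    obtain ⟨d, hd⟩ := ih (q - C (q.coeff n / (p n).coeff n) * p n) (by
      intro m hm
      rw [coeff_sub, coeff_C_mul]
      rcases hm.eq_or_lt with rfl | h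
      · have := (lc hp n).ne'
        field_simp
        ring
      · rw [hq m h, coeff_big hp h]; ring)
    refine ⟨fun j => if j = n then q.coeff n / (p n).coeff n else d j, ?_⟩
    rw [Finset.sum_range_succ]
    have : ∑ j ∈ Finset.range n, C (if j = n then q.coeff n / (p n).coeff n else d j) * p j
        = ∑ j ∈ Finset.range n, C (d j) * p j := by
      apply Finset.sum_congr rfl
      intro j hj
      rw [if_neg (Finset.mem_range.1 hj).ne]
    rw [this, ← hd]
    simp

lemma EE_sum_mul {p : ℕ → ℝ[X]} (hp : IsLegendreONB p) (n : ℕ) (d : ℕ → ℝ) (j : ℕ) :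
    EE ((∑ i ∈ Finset.range n, C (d i) * p i) * p j) = if j < n then d j else 0 := by
  rw [Finset.sum_mul, map_sum]
  simp only [mul_assoc, EE_C_mul, orth hp]
  simp

lemma EE_sum_sq {p : ℕ → ℝ[X]} (hp : IsLegendreONB p) (n : ℕ) (d : ℕ → ℝ) :
    EE ((∑ i ∈ Finset.range n, C (d i) * p i) * (∑ i ∈ Finset.range n, C (d i) * p i))
      = ∑ i ∈ Finset.range n, d i ^ 2 := by
  conv_lhs => rw [Finset.mul_sum, map_sum]
  apply Finset.sum_congr rfl
  intro i hi
  rw [mul_left_comm, EE_C_mul, EE_sum_mul hp, if_pos (Finset.mem_range.1 hi)]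
  ring

lemma low {p : ℕ → ℝ[X]} (hp : IsLegendreONB p) (n : ℕ) (q : ℝ[X]) (hq : ∀ m, n ≤ m → q.coeff m = 0) : EE (q * p n) = 0 := by
  obtain ⟨d, rfl⟩ := expand hp n q hq
  rw [EE_sum_mul hp]; simp

lemma zero_of {p : ℕ → ℝ[X]} (hp : IsLegendreONB p) (n : ℕ) (q : ℝ[X]) (hq : ∀ m, n ≤ m → q.coeff m = 0)
    (h : ∀ j, j < n → EE (q * p j) = 0) : q = 0 := by
  obtain ⟨d, rfl⟩ := expand hp n q hq
  apply Finset.sum_eq_zero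
  intro j hj
  have := h j (Finset.mem_range.1 hj)
  rw [EE_sum_mul hp, if_pos (Finset.mem_range.1 hj)] at this
  simp [this]

lemma top {p : ℕ → ℝ[X]} (hp : IsLegendreONB p) (n : ℕ) (q : ℝ[X]) (hq : ∀ m, n < m → q.coeff m = 0) :
    EE (q * p n) * (p n).coeff n = q.coeff n := by
  have h := low hp n (q - C (q.coeff n / (p n).coeff n) * p n) (by
      intro m hm
      rw [coeff_sub, coeff_C_mul]
      have := (lc hp n).ne'
      rcases hm.eq_or_lt with rfl | h
      · field_simp
        ring
      · rw [hq m h, coeff_big hp h]; ring)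
  rw [sub_mul, map_sub, mul_assoc, EE_C_mul, orth hp, if_pos rfl] at h
  have := (lc hp n).ne'
  field_simp at h
  linarith

lemma parity {p : ℕ → ℝ[X]} (hp : IsLegendreONB p) (n : ℕ) : (p n).comp (-X) = C ((-1) ^ n) * p n := by
  have hc : ∀ (f : ℝ[X]) m, (f.comp (-X)).coeff m = (-1) ^ m * f.coeff m := by
    intro f m
    rw [show (-X : ℝ[X]) = C (-1) * X by simp, comp_C_mul_X_coeff]
    ring
  have hn := (lc hp n).ne'
  rw [← sub_eq_zero]
  apply zero_of hp n
  · intro m hm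
    rw [coeff_sub, hc, coeff_C_mul]
    rcases hm.eq_or_lt with rfl | h
    · ring
    · rw [coeff_big hp h]; ring
  · intro j hj
    rw [sub_mul, map_sub, mul_assoc, EE_C_mul, orth hp, if_neg hj.ne', ← EE_neg_comp]
    rw [mul_comp, comp_assoc]
    have : (-X : ℝ[X]).comp (-X) = X := by simp
    rw [this, comp_X, mul_comm, low hp]
    · ring
    · intro m hm
      rw [hc, coeff_big hp (by omega)]; ring

lemma eval_neg_one {p : ℕ → ℝ[X]} (hp : IsLegendreONB p) (n : ℕ) : (p n).eval (-1) = (-1) ^ n * (p n).eval 1 := by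
  have := congrArg (eval 1) (parity hp n)
  simpa [eval_comp] using this

lemma EE_X_diag {p : ℕ → ℝ[X]} (hp : IsLegendreONB p) (n : ℕ) : EE (X * p n * p n) = 0 := by
  have h := EE_neg_comp (X * p n * p n)
  rw [mul_comp, mul_comp, parity hp, X_comp] at h
  have e : -X * (C ((-1) ^ n) * p n) * (C ((-1) ^ n) * p n) = - (X * p n * p n) := by
    have : (C ((-1 : ℝ) ^ n) : ℝ[X]) * C ((-1 : ℝ) ^ n) = 1 := by
      rw [← C_mul, ← mul_pow]; simp
    linear_combination (-(X * p n * p n)) * this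
  rw [e, map_neg] at h
  linarith

lemma eval_one_sq {p : ℕ → ℝ[X]} (hp : IsLegendreONB p) (n : ℕ) : (p n).eval 1 ^ 2 = 2 * n + 1 := by
  have h := EE_deriv (X * (p n * p n))
  have e : derivative (X * (p n * p n)) = p n * p n + C 2 * ((X * derivative (p n)) * p n) := by
    simp only [derivative_mul, derivative_X]
    have : (C 2 : ℝ[X]) = 2 := rfl
    rw [this]; ring
  have t := top hp n (X * derivative (p n)) (by
    intro m hm
    obtain ⟨m, rfl⟩ : ∃ k, m = k + 1 := ⟨m - 1, by omega⟩
    rw [coeff_X_mul, coeff_derivative, coeff_big hp hm]; ring)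
  have t2 : (X * derivative (p n)).coeff n = n * (p n).coeff n := by
    cases n with
    | zero => simp
    | succ n => rw [coeff_X_mul, coeff_derivative]; push_cast; ring
  rw [t2] at t
  have t3 := mul_right_cancel₀ (lc hp n).ne' t
  rw [e, map_add, EE_C_mul, t3, orth hp, if_pos rfl] at h
  simp only [eval_mul, eval_X, eval_neg_one hp] at h
  have s : ((-1 : ℝ) ^ n) * (-1) ^ n = 1 := by rw [← mul_pow]; simp
  linear_combination -h - (p n).eval 1 ^ 2 / 2 * s

/-- recurrence coefficient -/
noncomputable def aa (p : ℕ → ℝ[X]) (n : ℕ) : ℝ := EE (X * p n * p (n + 1))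

lemma aa_sq {p : ℕ → ℝ[X]} (hp : IsLegendreONB p) (n : ℕ) : aa p n ^ 2 * ((2 * n + 1) * (2 * n + 3)) = (n + 1) ^ 2 := by
  have h := EE_deriv (p n * p (n + 1))
  rw [derivative_mul, map_add, low hp (n + 1), mul_comm (p n)] at h
  swap
  · intro m hm
    rw [coeff_derivative, coeff_big hp (by omega)]; ring
  have t := top hp n (derivative (p (n + 1))) (by
    intro m hm
    rw [coeff_derivative, coeff_big hp (by omega)]; ring)
  have t' := top hp (n + 1) (X * p n) (by
    intro m hm
    obtain ⟨m, rfl⟩ : ∃ k, m = k + 1 := ⟨m - 1, by omega⟩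
    rw [coeff_X_mul, coeff_big hp (by omega)])
  rw [coeff_X_mul] at t'
  change aa p n * _ = _ at t'
  rw [coeff_derivative] at t
  have s : ((-1 : ℝ) ^ n) * (-1) ^ n = 1 := by rw [← mul_pow]; simp
  simp only [eval_mul, eval_neg_one hp, pow_succ] at h
  have h' : EE (derivative (p (n + 1)) * p n) = (p n).eval 1 * (p (n + 1)).eval 1 := by
    linear_combination h + (p n).eval 1 * (p (n + 1)).eval 1 / 2 * s
  have hprod : aa p n * ((p n).eval 1 * (p (n + 1)).eval 1) = n + 1 := by
    rw [← h']
    apply mul_right_cancel₀ (mul_pos (lc hp n) (lc hp (n + 1))).ne'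
    linear_combination (aa p n * (p (n + 1)).coeff (n + 1)) * t
      + (p (n + 1)).coeff (n + 1) * (n + 1) * t'
  have e1 := eval_one_sq hp n
  have e2 := eval_one_sq hp (n + 1)
  push_cast at e2
  calc _ = (aa p n * ((p n).eval 1 * (p (n + 1)).eval 1)) ^ 2 := by
        rw [mul_pow, mul_pow, e1, e2]; ring
    _ = _ := by rw [hprod]

lemma aa_ne {p : ℕ → ℝ[X]} (hp : IsLegendreONB p) (n : ℕ) : aa p n ≠ 0 := by
  intro h
  have := aa_sq hp n
  rw [h] at this
  have h2 : (0 : ℝ) < (n + 1) ^ 2 := by positivity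
  linarith

lemma rec_zero {p : ℕ → ℝ[X]} (hp : IsLegendreONB p) : X * p 0 = C (aa p 0) * p 1 := by
  rw [← sub_eq_zero]
  apply zero_of hp 2
  · intro m hm
    obtain ⟨m, rfl⟩ : ∃ k, m = k + 1 := ⟨m - 1, by omega⟩
    rw [coeff_sub, coeff_C_mul, coeff_X_mul, coeff_big hp (by omega), coeff_big hp (by omega)]
    ring
  · intro j hj
    rw [sub_mul, map_sub, mul_assoc (C _), EE_C_mul, orth hp]
    interval_cases j
    · rw [EE_X_diag hp]; simp
    · simp [aa]

lemma rec_succ {p : ℕ → ℝ[X]} (hp : IsLegendreONB p) (n : ℕ) :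
    X * p (n + 1) = C (aa p (n + 1)) * p (n + 2) + C (aa p n) * p n := by
  rw [← sub_eq_zero]
  apply zero_of hp (n + 3)
  · intro m hm
    obtain ⟨m, rfl⟩ : ∃ k, m = k + 1 := ⟨m - 1, by omega⟩
    rw [coeff_sub, coeff_add, coeff_C_mul, coeff_C_mul, coeff_X_mul, coeff_big hp (by omega),
      coeff_big hp (by omega), coeff_big hp (by omega)]
    ring
  · intro j hj
    rw [sub_mul, add_mul, map_sub, map_add, mul_assoc (C _), EE_C_mul, mul_assoc (C _), EE_C_mul,
      orth hp, orth hp]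
    rcases (show j < n ∨ j = n ∨ j = n + 1 ∨ j = n + 2 by omega) with h | rfl | rfl | rfl
    · rw [if_neg (by omega), if_neg (by omega), mul_right_comm, low hp (n + 1)]
      · ring
      · intro m hm
        obtain ⟨m, rfl⟩ : ∃ k, m = k + 1 := ⟨m - 1, by omega⟩
        rw [coeff_X_mul, coeff_big hp (by omega)]
    · rw [if_neg (by omega), if_pos rfl, mul_right_comm, ← aa]; ring
    · rw [if_neg (by omega), if_neg (by omega), EE_X_diag hp]; ring
    · rw [if_pos rfl, if_neg (by omega), ← aa]; ring

lemma u_rec {p : ℕ → ℝ[X]} (hp : IsLegendreONB p) (n : ℕ) : aa p (n + 1) * (p (n + 2)).eval 0 = - (aa p n * (p n).eval 0) := by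
  have := congrArg (eval 0) (rec_succ hp n)
  simp at this
  linarith

lemma u_one {p : ℕ → ℝ[X]} (hp : IsLegendreONB p) : (p 1).eval 0 = 0 := by
  have := congrArg (eval 0) (rec_zero hp)
  simpa [aa_ne hp 0] using this

lemma u_zero {p : ℕ → ℝ[X]} (hp : IsLegendreONB p) : (p 0).eval 0 ^ 2 = 1 := by
  have h : p 0 = C ((p 0).eval 0) := by
    have := eq_C_of_degree_le_zero (p := p 0) (by rw [hp.1 0]; simp)
    rw [this]; simp
  have o := orth hp 0 0
  rw [h, if_pos rfl, EE_apply] at o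
  simp at o
  nlinarith

lemma c_rec {p : ℕ → ℝ[X]} (hp : IsLegendreONB p) (n : ℕ) : aa p (n + 1) * (derivative (p (n + 2))).eval 0
    + aa p n * (derivative (p n)).eval 0 = (p (n + 1)).eval 0 := by
  have := congrArg (fun q => eval 0 (derivative q)) (rec_succ hp n)
  simp at this
  linarith

lemma c_one {p : ℕ → ℝ[X]} (hp : IsLegendreONB p) : aa p 0 * (derivative (p 1)).eval 0 = (p 0).eval 0 := by
  have := congrArg (fun q => eval 0 (derivative q)) (rec_zero hp)
  simp at this
  linarith

lemma c_zero {p : ℕ → ℝ[X]} (hp : IsLegendreONB p) : (derivative (p 0)).eval 0 = 0 := by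
  have := eq_C_of_degree_le_zero (p := p 0) (by rw [hp.1 0]; simp)
  rw [this]; simp

lemma c_eq {p : ℕ → ℝ[X]} (hp : IsLegendreONB p) (n : ℕ) : (derivative (p (n + 1))).eval 0 = (2 * n + 3) * aa p n * (p n).eval 0 := by
  induction n using Nat.twoStepInduction with
  | zero =>
    apply mul_left_cancel₀ (aa_ne hp 0)
    have := aa_sq hp 0
    push_cast at *
    linear_combination c_one hp - (p 0).eval 0 * this
  | one =>
    apply mul_left_cancel₀ (aa_ne hp 1)
    have := c_rec hp 0
    simp only [zero_add, c_zero hp, u_one hp] at this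
    rw [u_one hp]
    simp only [Nat.reduceAdd]
    linear_combination this
  | more n ih _ =>
    apply mul_left_cancel₀ (aa_ne hp (n + 2))
    have h1 := aa_sq hp (n + 1)
    have h2 := aa_sq hp (n + 2)
    have r := c_rec hp (n + 1)
    have ur := u_rec hp n
    rw [ih] at r
    push_cast at *
    have e1 : (2 * (n + 2) + 3 : ℝ) * aa p (n + 2) ^ 2 = 1 + (2 * n + 3) * aa p (n + 1) ^ 2 := by
      have : (2 * n + 5 : ℝ) ≠ 0 := by positivity
      apply mul_right_cancel₀ this
      linear_combination h2 - h1
    linear_combination r - (p (n + 2)).eval 0 * e1 - (2 * n + 3) * aa p (n + 1) * ur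

lemma u_bd {p : ℕ → ℝ[X]} (hp : IsLegendreONB p) (n : ℕ) : (p n).eval 0 ^ 2 * (n + 1) ≤ 2 * n + 1 := by
  induction n using Nat.twoStepInduction with
  | zero => simp [u_zero hp]
  | one => norm_num [u_one hp]
  | more n ih _ =>
    have h1 := aa_sq hp n
    have h2 := aa_sq hp (n + 1)
    have ur : aa p (n + 1) ^ 2 * (p (n + 2)).eval 0 ^ 2 = aa p n ^ 2 * (p n).eval 0 ^ 2 := by
      rw [← mul_pow, u_rec hp]; ring
    push_cast at *
    set U := (p n).eval 0 ^ 2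
    set V := (p (n + 2)).eval 0 ^ 2
    have key : V * ((n + 2) ^ 2 * (2 * n + 1)) = U * (n + 1) ^ 2 * (2 * n + 5) := by
      linear_combination (2 * n + 1) * (2 * n + 3) * (2 * n + 5) * ur
        - V * (2 * n + 1) * h2 + U * (2 * n + 5) * h1
    have k2 : V * ((n + 2) ^ 2) ≤ (n + 1) * (2 * n + 5) := by
      have hpos : (0 : ℝ) < 2 * n + 1 := by positivity
      refine le_of_mul_le_mul_right ?_ hpos
      have : U * (n + 1) * ((n + 1) * (2 * n + 5)) ≤ (2 * n + 1) * ((n + 1) * (2 * n + 5)) := by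
        gcongr
      nlinarith
    have hpos : (0 : ℝ) < (n + 2) ^ 2 := by positivity
    refine le_of_mul_le_mul_right ?_ hpos
    have h3 : V * ((n + 2) ^ 2) * (n + 3) ≤ (n + 1) * (2 * n + 5) * (n + 3) := by gcongr
    have hn : (0 : ℝ) ≤ n := by positivity
    nlinarith

lemma c_bd {p : ℕ → ℝ[X]} (hp : IsLegendreONB p) (n : ℕ) : (derivative (p n)).eval 0 ^ 2 ≤ (2 * n + 1) * n := by
  cases n with
  | zero => simp [c_zero hp]
  | succ n =>
    rw [c_eq hp]
    have h1 := aa_sq hp n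
    have h2 := u_bd hp n
    push_cast
    have hpos : (0 : ℝ) < 2 * n + 1 := by positivity
    refine le_of_mul_le_mul_right ?_ hpos
    have : (p n).eval 0 ^ 2 * (n + 1) * ((n + 1) * (2 * n + 3))
      ≤ (2 * n + 1) * ((n + 1) * (2 * n + 3)) := by gcongr
    calc _ = (p n).eval 0 ^ 2 * (2 * n + 3) * (aa p n ^ 2 * ((2 * n + 1) * (2 * n + 3))) := by ring
      _ = (p n).eval 0 ^ 2 * (n + 1) * ((n + 1) * (2 * n + 3)) := by rw [h1]; ring
      _ ≤ _ := this
      _ = _ := by ring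

/-- The kernel as a polynomial. -/
noncomputable def kk (p : ℕ → ℝ[X]) (n : ℕ) : ℝ[X] :=
  ∑ m ∈ Finset.range (n + 1), C ((derivative (p m)).eval 0) * p m

lemma kk_sq {p : ℕ → ℝ[X]} (hp : IsLegendreONB p) (n : ℕ) : EE (kk p n * kk p n) ≤ 3 * (n : ℝ) ^ 3 := by
  rw [kk, EE_sum_sq hp]
  induction n with
  | zero => simp [c_zero hp]
  | succ n ih =>
    rw [Finset.sum_range_succ]
    have := c_bd hp (n + 1)
    push_cast at *
    have hn : (0 : ℝ) ≤ n := by positivity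
    nlinarith [sq_nonneg (n : ℝ)]

lemma X_kk {p : ℕ → ℝ[X]} (hp : IsLegendreONB p) (n : ℕ) : X * kk p n + C (aa p n * (derivative (p (n + 1))).eval 0) * p n =
    ∑ j ∈ Finset.range (n + 1), C ((p j).eval 0) * p j
      + C (aa p n * (derivative (p n)).eval 0) * p (n + 1) := by
  induction n with
  | zero =>
    simp [kk, c_zero hp, ← c_one hp]
  | succ n ih =>
    rw [kk, Finset.sum_range_succ, ← kk, Finset.sum_range_succ, ← c_rec hp n]
    have r := rec_succ hp n
    simp only [C_mul, C_add] at *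
    linear_combination ih + C ((derivative (p (n + 1))).eval 0) * r

lemma X_kk_sq {p : ℕ → ℝ[X]} (hp : IsLegendreONB p) (n : ℕ) : EE ((X * kk p (n + 1)) * (X * kk p (n + 1))) ≤ 8 * ((n : ℝ) + 1) ^ 2 := by
  have h := X_kk hp (n + 1)
  set d : ℕ → ℝ := fun j => if j < n + 1 then (p j).eval 0 else
    if j = n + 1 then aa p n * (derivative (p n)).eval 0 else
      aa p (n + 1) * (derivative (p (n + 1))).eval 0 with hd
  have hs : ∑ j ∈ Finset.range (n + 1), C (d j) * p j
      = ∑ j ∈ Finset.range (n + 1), C ((p j).eval 0) * p j := by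
    apply Finset.sum_congr rfl
    intro j hj
    simp only [hd]
    rw [if_pos (Finset.mem_range.1 hj)]
  have hs' : ∑ j ∈ Finset.range (n + 1), d j ^ 2
      = ∑ j ∈ Finset.range (n + 1), (p j).eval 0 ^ 2 := by
    apply Finset.sum_congr rfl
    intro j hj
    simp only [hd]
    rw [if_pos (Finset.mem_range.1 hj)]
  have d1 : d (n + 1) = aa p n * (derivative (p n)).eval 0 := by simp [hd]
  have d2 : d (n + 2) = aa p (n + 1) * (derivative (p (n + 1))).eval 0 := by simp [hd]
  have e : X * kk p (n + 1) = ∑ j ∈ Finset.range (n + 3), C (d j) * p j := by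
    rw [Finset.sum_range_succ, Finset.sum_range_succ, hs, d1, d2]
    rw [Finset.sum_range_succ, ← c_rec hp n] at h
    simp only [C_mul, C_add] at *
    linear_combination h
  rw [e, EE_sum_sq hp, Finset.sum_range_succ, Finset.sum_range_succ, hs', d1, d2]
  have b0 : ∑ j ∈ Finset.range (n + 1), (p j).eval 0 ^ 2 ≤ 2 * ((n : ℝ) + 1) := by
    have : ∑ j ∈ Finset.range (n + 1), (p j).eval 0 ^ 2 ≤ ∑ j ∈ Finset.range (n + 1), (2 : ℝ) := by
      apply Finset.sum_le_sum
      intro j _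
      have := u_bd hp j
      have hj : (0 : ℝ) < j + 1 := by positivity
      refine le_of_mul_le_mul_right ?_ hj
      linarith
    simpa [mul_comm] using this
  have ab : ∀ n, aa p n ^ 2 ≤ 1 / 3 := by
    intro n
    have := aa_sq hp n
    have hpos : (0 : ℝ) < (2 * n + 1) * (2 * n + 3) := by positivity
    refine le_of_mul_le_mul_right ?_ hpos
    rw [this]
    have hn : (0 : ℝ) ≤ n := by positivity
    nlinarith
  have b1 : (aa p n * (derivative (p n)).eval 0) ^ 2 ≤ 1 / 3 * ((2 * n + 1) * n) := by
    rw [mul_pow]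
    exact mul_le_mul (ab n) (c_bd hp n) (sq_nonneg _) (by norm_num)
  have b2 : (aa p (n + 1) * (derivative (p (n + 1))).eval 0) ^ 2
      ≤ 1 / 3 * ((2 * (n + 1) + 1) * (n + 1)) := by
    rw [mul_pow]
    have := c_bd hp (n + 1)
    push_cast at this
    exact mul_le_mul (ab _) this (sq_nonneg _) (by norm_num)
  have hn : (0 : ℝ) ≤ n := by positivity
  nlinarith

lemma int_eq (f : ℝ → ℝ) : ∫ r, f r ∂intervalUniform = (1 / 2 : ℝ) * ∫ r in (-1 : ℝ)..1, f r := by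
  rw [intervalUniform, integral_smul_measure, intervalIntegral.integral_of_le (by norm_num),
    integral_Icc_eq_integral_Ioc]
  simp

end LegAux

theorem stmt_6 (p : ℕ → Polynomial ℝ) (hp : IsLegendreONB p) (β : ℕ) (hβ : 1 ≤ β)
    (k : ℝ → ℝ)
    (hk : ∀ r, k r = ∑ m ∈ Finset.range (β + 1),
      (Polynomial.derivative (p m)).eval 0 * (p m).eval r) :
    (∫ r, (k r) ^ 2 ∂intervalUniform ≤ 3 * (β : ℝ) ^ 3) ∧
      (∫ r, (k r) ^ 2 * r ^ 2 ∂intervalUniform ≤ 8 * (β : ℝ) ^ 2) ∧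
      (∫ r, |k r * r ^ (β + 1)| ∂intervalUniform ≤ 2 * Real.sqrt 2 * β) := by
  have hk' : ∀ r, k r = (LegAux.kk p β).eval r := by
    intro r
    rw [hk, LegAux.kk, Polynomial.eval_finsetSum]
    simp
  have h1 := LegAux.kk_sq hp β
  have h2 : EE ((Polynomial.X * LegAux.kk p β) * (Polynomial.X * LegAux.kk p β))
      ≤ 8 * (β : ℝ) ^ 2 := by
    obtain ⟨n, rfl⟩ : ∃ n, β = n + 1 := ⟨β - 1, by omega⟩
    have := LegAux.X_kk_sq hp n
    push_cast
    exact this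
  have h2' : (1 / 2 : ℝ) * ∫ r in (-1 : ℝ)..1, (k r) ^ 2 * r ^ 2 ≤ 8 * (β : ℝ) ^ 2 := by
    convert h2 using 1
    rw [LegAux.EE_apply]
    congr 2
    ext r
    simp only [hk', Polynomial.eval_mul, Polynomial.eval_X]
    ring
  have hcont : Continuous k := by
    rw [show k = fun r => (LegAux.kk p β).eval r from funext hk']
    exact (LegAux.kk p β).continuous
  refine ⟨?_, ?_, ?_⟩
  · rw [LegAux.int_eq]
    convert h1 using 1
    rw [LegAux.EE_apply]
    congr 2
    ext r
    simp only [hk', Polynomial.eval_mul]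
    ring
  · rw [LegAux.int_eq]
    exact h2'
  · rw [LegAux.int_eq]
    have hb : (0 : ℝ) < β := by exact_mod_cast hβ
    have hs : (0 : ℝ) < Real.sqrt 2 := by positivity
    have hs2 : Real.sqrt 2 ^ 2 = 2 := Real.sq_sqrt (by norm_num)
    set A : ℝ := 2 * Real.sqrt 2 * β with hA
    have hApos : 0 < A := by positivity
    have hA2 : A ^ 2 = 8 * (β : ℝ) ^ 2 := by
      rw [hA, mul_pow, mul_pow, hs2]; ring
    have hle : ∫ r in (-1 : ℝ)..1, |k r * r ^ (β + 1)|
        ≤ ∫ r in (-1 : ℝ)..1, ((1 / (2 * A)) * ((k r) ^ 2 * r ^ 2) + A / 2) := by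
      apply intervalIntegral.integral_mono_on (by norm_num)
      · exact Continuous.intervalIntegrable (by fun_prop) _ _
      · exact Continuous.intervalIntegrable (by fun_prop) _ _
      · intro r hr
        have hr1 : |r| ^ β ≤ 1 := pow_le_one₀ (abs_nonneg _) (abs_le.2 hr)
        have e1 : |k r * r ^ (β + 1)| ≤ |k r * r| := by
          rw [pow_succ', ← mul_assoc, abs_mul, abs_pow]
          exact mul_le_of_le_one_right (abs_nonneg _) hr1
        refine e1.trans ?_
        have e2 : (k r) ^ 2 * r ^ 2 = |k r * r| ^ 2 := by rw [sq_abs]; ring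
        rw [e2]
        have e3 : (1 / (2 * A)) * |k r * r| ^ 2 + A / 2 - |k r * r|
            = (|k r * r| - A) ^ 2 / (2 * A) := by
          field_simp
          ring
        have e4 : 0 ≤ (|k r * r| - A) ^ 2 / (2 * A) := by positivity
        linarith
    rw [intervalIntegral.integral_add (Continuous.intervalIntegrable (by fun_prop) _ _)
      (Continuous.intervalIntegrable (by fun_prop) _ _),
      intervalIntegral.integral_const_mul, intervalIntegral.integral_const] at hle
    rw [← hA2] at h2'
    have h3 : 1 / (2 * A) * ((1 / 2 : ℝ) * ∫ r in (-1 : ℝ)..1, (k r) ^ 2 * r ^ 2)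
        ≤ 1 / (2 * A) * A ^ 2 := by gcongr
    have h4 : 1 / (2 * A) * A ^ 2 = A / 2 := by field_simp
    rw [smul_eq_mul] at hle
    linarith
end

section
/- Let f : ℝ^d → ℝ be convex, let δ > 0, and let k : [−1,1] → ℝ be a bounded measurable kernel such that r k(r) ≥ 0 for almost every r ∈ [−1,1] (for example k(r) = 3r). Then the smoothed function f̂_δ is convex on ℝ^d. -/
open MeasureTheory Metric

theorem stmt_8 (d : ℕ) (hd : 1 ≤ d) (f : EuclideanSpace ℝ (Fin d) → ℝ)
    (hconv : ConvexOn ℝ Set.univ f) (δ : ℝ) (hδ : 0 < δ)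
    (k : ℝ → ℝ) (hkmeas : Measurable k) (hkbdd : ∃ C, ∀ r ∈ Set.Icc (-1 : ℝ) 1, |k r| ≤ C)
    (hkpos : ∀ᵐ r ∂intervalUniform, 0 ≤ r * k r) :
    ConvexOn ℝ Set.univ (smoothed d f δ k) := by
  have hf : Continuous f := by
    have := hconv.continuousOn isOpen_univ
    exact continuousOn_univ.mp this
  obtain ⟨C, hC⟩ := hkbdd
  have hI : ∀ᵐ r ∂intervalUniform, r ∈ Set.Icc (-1 : ℝ) 1 := by
    unfold intervalUniform
    exact Measure.ae_smul_measure (ae_restrict_mem measurableSet_Icc) _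
  have hB : ∀ᵐ v ∂(ballUniform d), v ∈ closedBall (0 : EuclideanSpace ℝ (Fin d)) 1 := by
    unfold ballUniform
    exact Measure.ae_smul_measure (ae_restrict_mem measurableSet_closedBall) _
  have : IsFiniteMeasure intervalUniform := by
    unfold intervalUniform
    exact Measure.smul_finite _ (by simp)
  have : IsFiniteMeasure (ballUniform d) := by
    unfold ballUniform
    have : IsFiniteMeasure (volume.restrict
        (closedBall (0 : EuclideanSpace ℝ (Fin d)) 1)) :=
      ⟨by simpa using measure_closedBall_lt_top⟩
    refine Measure.smul_finite _ ?_
    exact ENNReal.inv_ne_top.mpr (measure_closedBall_pos _ _ one_pos).ne'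
  have hI' : ∀ᵐ p ∂(intervalUniform.prod (ballUniform d)), p.1 ∈ Set.Icc (-1 : ℝ) 1 :=
    Measure.quasiMeasurePreserving_fst.ae hI
  have hP' : ∀ᵐ p ∂(intervalUniform.prod (ballUniform d)), 0 ≤ p.1 * k p.1 :=
    Measure.quasiMeasurePreserving_fst.ae hkpos
  have hB' : ∀ᵐ p ∂(intervalUniform.prod (ballUniform d)),
      p.2 ∈ closedBall (0 : EuclideanSpace ℝ (Fin d)) 1 :=
    Measure.quasiMeasurePreserving_snd.ae hB
  have hint : ∀ x, Integrable (fun p : ℝ × EuclideanSpace ℝ (Fin d) =>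
      f (x + (p.1 * δ) • p.2) * (p.1 * k p.1)) (intervalUniform.prod (ballUniform d)) := by
    intro x
    have hcont : Continuous (fun p : ℝ × EuclideanSpace ℝ (Fin d) =>
      f (x + (p.1 * δ) • p.2)) := by fun_prop
    obtain ⟨M, hM⟩ := ((isCompact_Icc (a := (-1 : ℝ)) (b := 1)).prod
      (isCompact_closedBall (0 : EuclideanSpace ℝ (Fin d)) 1)).exists_bound_of_continuousOn
      hcont.continuousOn
    refine Integrable.of_bound (C := M * (1 * C)) ?_ ?_
    · exact (hcont.measurable.mul
        (measurable_fst.mul (hkmeas.comp measurable_fst))).aestronglyMeasurable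
    · filter_upwards [hI', hB'] with p h1 h2
      have hm := hM p ⟨h1, h2⟩
      have hc := hC p.1 h1
      have hr : |p.1| ≤ 1 := abs_le.mpr h1
      rw [norm_mul, norm_mul]
      simp only [Real.norm_eq_abs] at hm ⊢
      have := (abs_nonneg _).trans hm
      gcongr
  refine ⟨convex_univ, ?_⟩
  intro x _ y _ a b ha hb hab
  unfold smoothed
  rw [smul_eq_mul, smul_eq_mul, ← integral_const_mul, ← integral_const_mul,
    ← integral_add ((hint x).const_mul a) ((hint y).const_mul b)]
  refine integral_mono_ae (hint _) (((hint x).const_mul a).add ((hint y).const_mul b)) ?_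
  filter_upwards [hP'] with p hp
  have h := hconv.2 (Set.mem_univ (x + (p.1 * δ) • p.2))
    (Set.mem_univ (y + (p.1 * δ) • p.2)) ha hb hab
  have e : a • (x + (p.1 * δ) • p.2) + b • (y + (p.1 * δ) • p.2)
      = a • x + b • y + (p.1 * δ) • p.2 := by
    rw [smul_add, smul_add, add_add_add_comm, ← add_smul, hab, one_smul]
  rw [e, smul_eq_mul, smul_eq_mul] at h
  have := mul_le_mul_of_nonneg_right h hp
  linarith
end

section
/- Let g : ℝ → ℝ be defined by g(y) = y / (1 + y²). Then g is infinitely differentiable and for every integer β ≥ 0 and every y ∈ ℝ, the β-th derivative of g satisfies |g^{(β)}(y)| ≤ 2^{β+1} · β!. -/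
theorem stmt_19_ne (y : ℝ) : (y : ℂ) - Complex.I ≠ 0 := by
  intro h
  have := congrArg Complex.im h
  simp at this

theorem stmt_19_formula (g : ℝ → ℝ) (hg : ∀ y, g y = y / (1 + y ^ 2)) (n : ℕ) :
    iteratedDeriv n g =
      fun y : ℝ => ((-1) ^ n * (n.factorial : ℂ) * (((y : ℂ) - Complex.I)⁻¹) ^ (n + 1)).re := by
  induction n with
  | zero =>
    funext y
    simp [hg, Complex.inv_re, Complex.normSq_apply]
    ring
  | succ n ih =>
    rw [iteratedDeriv_succ, ih]
    funext y
    have hne := stmt_19_ne y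
    have h1 : HasDerivAt (fun z : ℂ => (z - Complex.I)⁻¹)
        (-1 / ((y : ℂ) - Complex.I) ^ 2) (y : ℂ) :=
      ((hasDerivAt_id (y : ℂ)).sub_const Complex.I).inv hne
    have h2 := ((h1.pow (n + 1)).const_mul ((-1) ^ n * (n.factorial : ℂ))).real_of_complex
    refine h2.deriv.trans ?_
    congr 1
    rw [Nat.factorial_succ]
    push_cast
    rw [div_eq_mul_inv, ← inv_pow]
    ring

theorem stmt_19 (g : ℝ → ℝ) (hg : ∀ y, g y = y / (1 + y ^ 2)) :
    ContDiff ℝ (⊤ : ℕ∞) g ∧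
      ∀ (β : ℕ) (y : ℝ), |iteratedDeriv β g y| ≤ 2 ^ (β + 1) * (Nat.factorial β) := by
  constructor
  · have : g = fun y => y / (1 + y ^ 2) := funext hg
    rw [this]
    exact contDiff_id.div (contDiff_const.add (contDiff_id.pow 2))
      (fun y => by positivity)
  · intro n y
    rw [stmt_19_formula g hg n]
    refine (Complex.abs_re_le_norm _).trans ?_
    have h1 : 1 ≤ ‖(y : ℂ) - Complex.I‖ := by
      have := Complex.abs_im_le_norm ((y : ℂ) - Complex.I)
      simpa using this
    have h2 : ‖((y : ℂ) - Complex.I)⁻¹‖ ^ (n + 1) ≤ 1 := by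
      apply pow_le_one₀ (norm_nonneg _)
      rw [norm_inv]
      exact inv_le_one_of_one_le₀ h1
    have h3 : (1 : ℝ) ≤ 2 ^ (n + 1) := one_le_pow₀ (by norm_num)
    have h4 : (0 : ℝ) ≤ (n.factorial : ℝ) := by positivity
    rw [norm_mul, norm_mul, norm_pow, norm_pow, norm_neg, norm_one, one_pow, one_mul,
      Complex.norm_natCast]
    nlinarith
end
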